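/- Let c1,c2,c3 ∈ ℝ and define f(γ) = mid(|c1|(1−γ), |c2|(1−γ), |c3|(1−γ)²) for γ ∈ [0,1]. Then the set {γ ∈ (0,1) : f is not differentiable at γ} has exactly two elements if and only if |c3| > |c1|, |c3| > |c2|, c1 ≠ 0, c2 ≠ 0, and |c1| ≠ |c2| (necessary and sufficient conditions for a double sudden change under the generalized amplitude damping channel at p = 1/2). -/

import Mathlib

/-- The intermediate (median) value of three reals. -/
noncomputable def mid (a b c : ℝ) : ℝ := a + b + c - max a (max b c) - min a (min b c)

theorem mid_swap (a b c : ℝ) : mid a b c = mid b a c := by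
  unfold mid
  rw [max_left_comm, min_left_comm]
  ring

theorem mid_eq_max_min {a b : ℝ} (c : ℝ) (hab : a ≤ b) : mid a b c = max a (min b c) := by
  unfold mid
  rcases le_total b c with h | h <;> rcases le_total a c with h' | h' <;>
    simp [h, h', hab] <;> linarith

/-- Two functions that touch at a point, one lying above the other nearby, have the same
derivative there. -/
theorem HasDerivAt.eq_of_eventually_le {f g : ℝ → ℝ} {f' g' x : ℝ} (hf : HasDerivAt f f' x)
    (hg : HasDerivAt g g' x) (hx : g x = f x) (hle : ∀ᶠ y in nhds x, g y ≤ f y) : f' = g' := by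
  have hmin : IsLocalMin (f - g) x := by
    filter_upwards [hle] with y hy
    simp only [Pi.sub_apply]
    linarith
  exact sub_eq_zero.1 (hmin.hasDerivAt_eq_zero (hf.sub hg))

theorem hasDerivAt_mul_one_sub (a x : ℝ) : HasDerivAt (fun y : ℝ => a * (1 - y)) (-a) x := by
  simpa using ((hasDerivAt_id x).const_sub 1).const_mul a

theorem hasDerivAt_mul_one_sub_sq (c x : ℝ) :
    HasDerivAt (fun y : ℝ => c * (1 - y) ^ 2) (-(2 * (c * (1 - x)))) x := by
  refine ((((hasDerivAt_id' x).const_sub 1).pow 2).const_mul c).congr_deriv ?_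
  norm_num
  ring

theorem not_differentiableAt_mid_iff {a b c x : ℝ} (ha : 0 ≤ a) (hab : a ≤ b) (hc : 0 ≤ c)
    (hx : x < 1) :
    ¬ DifferentiableAt ℝ (fun y => mid (a * (1 - y)) (b * (1 - y)) (c * (1 - y) ^ 2)) x ↔
      a < b ∧ 0 < c ∧ (c * (1 - x) = a ∨ c * (1 - x) = b) := by
  set f : ℝ → ℝ := fun y => mid (a * (1 - y)) (b * (1 - y)) (c * (1 - y) ^ 2)
  have hval : ∀ y < 1, f y = max (a * (1 - y)) (min (b * (1 - y)) (c * (1 - y) ^ 2)) :=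
    fun y hy => mid_eq_max_min _ (mul_le_mul_of_nonneg_right hab (by linarith))
  have hlt : ∀ᶠ y in nhds x, y < 1 := eventually_lt_nhds hx
  have hcont : ContinuousAt (fun y : ℝ => c * (1 - y)) x := by fun_prop
  have hlow : ∀ y < 1, c * (1 - y) ≤ a → f y = a * (1 - y) := by
    intro y hy h
    rw [hval y hy]
    exact max_eq_left ((min_le_right _ _).trans (by nlinarith))
  have hhigh : ∀ y < 1, b ≤ c * (1 - y) → f y = b * (1 - y) := by
    intro y hy h
    rw [hval y hy, min_eq_left (by nlinarith), max_eq_right (by nlinarith)]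
  have hmiddle : ∀ y < 1, a ≤ c * (1 - y) → c * (1 - y) ≤ b → f y = c * (1 - y) ^ 2 := by
    intro y hy h h'
    rw [hval y hy, min_eq_right (by nlinarith), max_eq_right (by nlinarith)]
  constructor
  · intro hnd
    have hlin : ∀ d : ℝ, ¬ ∀ᶠ y in nhds x, f y = d * (1 - y) := fun d h =>
      hnd ((hasDerivAt_mul_one_sub d x).differentiableAt.congr_of_eventuallyEq h)
    have hquad : ¬ ∀ᶠ y in nhds x, f y = c * (1 - y) ^ 2 := fun h =>
      hnd ((hasDerivAt_mul_one_sub_sq c x).differentiableAt.congr_of_eventuallyEq h)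
    refine ⟨hab.lt_of_ne ?_, hc.lt_of_ne ?_, ?_⟩
    · rintro rfl
      refine hlin a ?_
      filter_upwards [hlt] with y hy
      rw [hval y hy, max_eq_left (min_le_left _ _)]
    · rintro rfl
      refine hlin a ?_
      filter_upwards [hlt] with y hy
      exact hlow y hy (by simpa using ha)
    · by_contra! hne
      rcases hne.1.lt_or_gt with h | h
      · refine hlin a ?_
        filter_upwards [hlt, hcont.eventually_lt_const h] with y hy h'
        exact hlow y hy h'.le
      · rcases hne.2.lt_or_gt with h₂ | h₂
        · refine hquad ?_
          filter_upwards [hlt, hcont.eventually_const_lt h, hcont.eventually_lt_const h₂]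
            with y hy h' h''
          exact hmiddle y hy h'.le h''.le
        · refine hlin b ?_
          filter_upwards [hlt, hcont.eventually_const_lt h₂] with y hy h'
          exact hhigh y hy h'.le
  · rintro ⟨hab', hc', h⟩ hd
    have hpos : 0 < c * (1 - x) := mul_pos hc' (by linarith)
    have hquad := hasDerivAt_mul_one_sub_sq c x
    rcases h with h | h
    · have hfx := hlow x hx h.le
      have h₁ := hd.hasDerivAt.eq_of_eventually_le (hasDerivAt_mul_one_sub a x) hfx.symm (by
        filter_upwards [hlt] with y hy
        rw [hval y hy]
        exact le_max_left _ _)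
      have h₂ := hd.hasDerivAt.eq_of_eventually_le hquad
        (hmiddle x hx h.ge (h.le.trans hab)).symm (by
          filter_upwards [hlt, hcont.eventually_lt_const (h.trans_lt hab')] with y hy h'
          rw [hval y hy]
          exact le_max_of_le_right (le_min (by nlinarith) le_rfl))
      linarith
    · have hfx := hhigh x hx h.ge
      have h₁ := (hasDerivAt_mul_one_sub b x).eq_of_eventually_le hd.hasDerivAt hfx (by
        filter_upwards [hlt] with y hy
        rw [hval y hy]
        exact max_le (by nlinarith) (min_le_left _ _))
      have h₂ := hquad.eq_of_eventually_le hd.hasDerivAt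
        (hmiddle x hx (hab.trans h.ge) h.le) (by
          filter_upwards [hlt, hcont.eventually_const_lt (hab'.trans_eq h.symm)] with y hy h'
          rw [hval y hy]
          exact max_le (by nlinarith) (min_le_right _ _))
      linarith

theorem ncard_not_differentiableAt_mid_eq_two_iff {a b c : ℝ} (ha : 0 ≤ a) (hab : a ≤ b)
    (hc : 0 ≤ c) :
    {x ∈ Set.Ioo (0 : ℝ) 1 | ¬ DifferentiableAt ℝ
      (fun y => mid (a * (1 - y)) (b * (1 - y)) (c * (1 - y) ^ 2)) x}.ncard = 2 ↔
      0 < a ∧ a < b ∧ b < c := by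
  have hmem : ∀ x, x ∈ {x ∈ Set.Ioo (0 : ℝ) 1 | ¬ DifferentiableAt ℝ
      (fun y => mid (a * (1 - y)) (b * (1 - y)) (c * (1 - y) ^ 2)) x} ↔
      (0 < x ∧ x < 1) ∧ a < b ∧ 0 < c ∧ (c * (1 - x) = a ∨ c * (1 - x) = b) := fun x =>
    and_congr_right fun hx => not_differentiableAt_mid_iff ha hab hc hx.2
  rw [Set.ncard_eq_two]
  constructor
  · rintro ⟨x, y, hxy, hS⟩
    obtain ⟨⟨hx0, hx1⟩, hab', hc', hx⟩ := (hmem x).1 (hS ▸ Set.mem_insert x _)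
    obtain ⟨⟨hy0, hy1⟩, -, -, hy⟩ := (hmem y).1 (hS ▸ Set.mem_insert_of_mem x rfl)
    have hne : c * (1 - x) ≠ c * (1 - y) := fun h =>
      hxy (by linarith [mul_left_cancel₀ hc'.ne' h])
    rcases hx with hx | hx <;> rcases hy with hy | hy
    · exact absurd (hx.trans hy.symm) hne
    · exact ⟨by nlinarith, hab', by nlinarith⟩
    · exact ⟨by nlinarith, hab', by nlinarith⟩
    · exact absurd (hx.trans hy.symm) hne
  · rintro ⟨ha', hab', hbc⟩
    have hc' : 0 < c := by linarith
    have hsolve : ∀ x d : ℝ, c * (1 - x) = d ↔ x = 1 - d / c := by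
      intro x d
      rw [eq_sub_iff_add_eq, ← eq_sub_iff_add_eq', div_eq_iff hc'.ne', mul_comm, eq_comm]
    have hIoo : ∀ d, 0 < d → d < c → 0 < 1 - d / c ∧ 1 - d / c < 1 := fun d h h' =>
      ⟨sub_pos.2 ((div_lt_one hc').2 h'), sub_lt_self _ (div_pos h hc')⟩
    refine ⟨1 - a / c, 1 - b / c, ?_, ?_⟩
    · intro h
      exact hab'.ne ((div_left_inj' hc'.ne').1 (sub_right_injective h))
    · ext x
      rw [hmem, hsolve, hsolve, Set.mem_insert_iff, Set.mem_singleton_iff]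
      refine ⟨fun h => h.2.2.2, fun h => ⟨?_, hab', hc', h⟩⟩
      rcases h with rfl | rfl
      · exact hIoo a ha' (hab'.trans hbc)
      · exact hIoo b (ha'.trans hab') hbc

/-- Necessary and sufficient conditions for a double sudden change of the 1-norm geometric
discord under the generalized amplitude damping channel at `p = 1/2`. -/
theorem gad_doubleSuddenChange_iff (c₁ c₂ c₃ : ℝ) (f : ℝ → ℝ)
    (hf : ∀ γ, f γ = mid (|c₁| * (1 - γ)) (|c₂| * (1 - γ)) (|c₃| * (1 - γ) ^ 2)) :
    {γ ∈ Set.Ioo (0 : ℝ) 1 | ¬ DifferentiableAt ℝ f γ}.ncard = 2 ↔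
      |c₁| < |c₃| ∧ |c₂| < |c₃| ∧ c₁ ≠ 0 ∧ c₂ ≠ 0 ∧ |c₁| ≠ |c₂| := by
  obtain rfl : f = fun γ => mid (|c₁| * (1 - γ)) (|c₂| * (1 - γ)) (|c₃| * (1 - γ) ^ 2) :=
    funext hf
  rw [← abs_pos (a := c₁), ← abs_pos (a := c₂)]
  rcases le_total |c₁| |c₂| with h | h
  · rw [ncard_not_differentiableAt_mid_eq_two_iff (abs_nonneg _) h (abs_nonneg _)]
    exact ⟨fun ⟨h₁, h₂, h₃⟩ => ⟨h₂.trans h₃, h₃, h₁, h₁.trans h₂, h₂.ne⟩,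
      fun ⟨_, h₂, h₃, _, h₅⟩ => ⟨h₃, h.lt_of_ne h₅, h₂⟩⟩
  · simp_rw [mid_swap (|c₁| * _)]
    rw [ncard_not_differentiableAt_mid_eq_two_iff (abs_nonneg _) h (abs_nonneg _)]
    exact ⟨fun ⟨h₁, h₂, h₃⟩ => ⟨h₃, h₂.trans h₃, h₁.trans h₂, h₁, h₂.ne'⟩,
      fun ⟨h₁, _, _, h₄, h₅⟩ => ⟨h₄, h.lt_of_ne h₅.symm, h₁⟩⟩
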